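/- There exists a positive integer n₀ such that for every integer n ≥ n₀, setting q = 2^n, and for all A, B, C, D, E ∈ 𝔽_{q²} such that: neither condition (C1) nor condition (C2) holds; (A D^q + C, A^{q+1} + C^{q+1} + D^{q+1} + 1) ≠ (0, 0); and h₁ ≠ 0, where h₁ := A^{q+1} B^{q+1} + A B^{2q} + A^q B² + B² C^q D^q + B^{q+1} C^{q+1} + B^{q+1} D^{q+1} + B^{q+1} + B^{2q} C D; the Dillon hexanomial f_{A,B,C,D,E} is not APN. -/

import Mathlib

/-- A function `f : F → F` is almost perfect nonlinear (APN) if for every nonzero `a`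
and every `b`, the equation `f (x + a) + f x = b` has at most two solutions. -/
def IsAPN {F : Type*} [Field F] (f : F → F) : Prop :=
  ∀ a b : F, a ≠ 0 → Set.ncard {x : F | f (x + a) + f x = b} ≤ 2

/-- The Dillon hexanomial `f_{A,B,C,D,E}(x) = A x³ + B x^{q+1} + C x^{2q+1} + D x^{q+2}
+ E x^{2q+2} + x^{3q}`. -/
def dillon {F : Type*} [Field F] (q : ℕ) (A B C D E : F) : F → F :=
  fun x => A * x ^ 3 + B * x ^ (q + 1) + C * x ^ (2 * q + 1) +
    D * x ^ (q + 2) + E * x ^ (2 * q + 2) + x ^ (3 * q)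

/-- Condition (C1): `A ≠ 0`, `C = D = 0`, `A^q B = B^q`, `A^q E = E^q`. -/
def CondC1 {F : Type*} [Field F] (q : ℕ) (A B C D E : F) : Prop :=
  A ≠ 0 ∧ C = 0 ∧ D = 0 ∧ A ^ q * B = B ^ q ∧ A ^ q * E = E ^ q

/-- Condition (C2): `A ≠ 0`, `C ≠ 0`, `D ≠ 0`, `A^{q+1} = 1`, `D = A C^q`,
`B^q = A^q B`, `E^q = A^q E`. -/
def CondC2 {F : Type*} [Field F] (q : ℕ) (A B C D E : F) : Prop :=
  A ≠ 0 ∧ C ≠ 0 ∧ D ≠ 0 ∧ A ^ (q + 1) = 1 ∧ D = A * C ^ q ∧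
    B ^ q = A ^ q * B ∧ E ^ q = A ^ q * E

/-- The key quantity `h₁` from the paper. -/
def h1Poly {F : Type*} [Field F] (q : ℕ) (A B C D : F) : F :=
  A ^ (q + 1) * B ^ (q + 1) + A * B ^ (2 * q) + A ^ q * B ^ 2 +
    B ^ 2 * C ^ q * D ^ q + B ^ (q + 1) * C ^ (q + 1) +
    B ^ (q + 1) * D ^ (q + 1) + B ^ (q + 1) + B ^ (2 * q) * C * D

/-- The absolute trace of a field with `2 ^ n` elements, as a sum of conjugates. -/
def sumConj {K : Type*} [Field K] (n : ℕ) (y : K) : K := ∑ i ∈ Finset.range n, y ^ 2 ^ i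

lemma sumConj_add {K : Type*} [Field K] [CharP K 2] (n : ℕ) (x y : K) :
    sumConj n (x + y) = sumConj n x + sumConj n y := by
  simp [sumConj, add_pow_char_pow, Finset.sum_add_distrib]

lemma sumConj_sq_add_self {K : Type*} [Field K] [CharP K 2] (n : ℕ) (x : K) :
    sumConj n (x ^ 2 + x) = x ^ 2 ^ n + x := by
  induction n with
  | zero => simp [sumConj, CharTwo.add_self_eq_zero]
  | succ n ih =>
    have h : sumConj (n + 1) (x ^ 2 + x) = sumConj n (x ^ 2 + x) + (x ^ 2 + x) ^ 2 ^ n :=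
      Finset.sum_range_succ _ _
    rw [h, ih, add_pow_char_pow, ← pow_mul, ← pow_succ']
    linear_combination CharTwo.add_self_eq_zero (x ^ 2 ^ n)

lemma sumConj_sq {K : Type*} [Field K] [CharP K 2] (n : ℕ) (x : K) :
    sumConj n x ^ 2 = sumConj n (x ^ 2) := by
  simp only [sumConj, sum_pow_char]
  exact Finset.sum_congr rfl fun i _ => by rw [← pow_mul, ← pow_mul, mul_comm]

lemma exists_sq_add_self_eq {K : Type*} [Field K] [Fintype K] [CharP K 2] {m : ℕ}
    (hK : Fintype.card K = 2 ^ (m + 1)) {y : K} (hy : sumConj (m + 1) y = 0) :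
    ∃ x : K, x ^ 2 + x = y := by
  classical
  let w : K →+ K :=
    { toFun := fun x => x ^ 2 + x
      map_zero' := by simp
      map_add' := fun x y => by rw [CharTwo.add_sq]; ring }
  have hker : Nat.card w.ker = 2 := by
    have : (w.ker : Set K) = {0, 1} := by
      ext x
      simp only [SetLike.mem_coe, AddMonoidHom.mem_ker, Set.mem_insert_iff,
        Set.mem_singleton_iff]
      change x ^ 2 + x = 0 ↔ _
      have h : x ^ 2 + x = x * (x + 1) := by ring
      rw [h, mul_eq_zero, CharTwo.add_eq_zero]
    rw [← SetLike.coe_sort_coe, this]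
    simp
  have hrange : Nat.card w.range = 2 ^ m := by
    have h := w.ker.card_mul_index
    rw [AddSubgroup.index_ker, hker, Nat.card_eq_fintype_card (α := K), hK, pow_succ'] at h
    exact Nat.eq_of_mul_eq_mul_left two_pos h
  by_contra hne
  have hS : (insert y (Finset.univ.image w)).card = 2 ^ m + 1 := by
    rw [Finset.card_insert_of_notMem, ← hrange, ← Set.ncard_coe_finset, Finset.coe_image,
      Finset.coe_univ, Set.image_univ, ← AddMonoidHom.coe_range]
    · rfl
    · intro h
      obtain ⟨x, -, hx⟩ := Finset.mem_image.1 h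
      exact hne ⟨x, hx⟩
  let P : Polynomial K := ∑ i ∈ Finset.range (m + 1), Polynomial.X ^ 2 ^ i
  have heval : ∀ z, P.eval z = sumConj (m + 1) z := fun z => by
    simp [P, sumConj, Polynomial.eval_finsetSum]
  have hdeg : P.natDegree ≤ 2 ^ m := by
    refine Polynomial.natDegree_sum_le_of_forall_le _ _ fun i hi => ?_
    rw [Polynomial.natDegree_X_pow]
    exact Nat.pow_le_pow_right two_pos (by have := Finset.mem_range.1 hi; omega)
  have hP : P = 0 := by
    refine Polynomial.eq_zero_of_natDegree_lt_card_of_eval_eq_zero' P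
      (insert y (Finset.univ.image w)) (fun z hz => ?_) (by omega)
    rw [heval]
    rcases Finset.mem_insert.1 hz with rfl | hz
    · exact hy
    · obtain ⟨x, -, rfl⟩ := Finset.mem_image.1 hz
      change sumConj (m + 1) (x ^ 2 + x) = 0
      rw [sumConj_sq_add_self, ← hK, FiniteField.pow_card, CharTwo.add_self_eq_zero]
  have h1 : P.coeff 1 = 1 := by
    simp only [P, Polynomial.finsetSum_coeff, Polynomial.coeff_X_pow]
    rw [Finset.sum_eq_single 0]
    · simp
    · intro i _ hi
      rw [if_neg]
      exact fun h => hi (by simpa using h.symm)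
    · simp
  simp [hP] at h1

lemma exists_sq_add_self_eq_linear_add_inv {K : Type*} [Field K] [Fintype K] [CharP K 2] {n : ℕ}
    (hn : 4 ≤ n) (hK : Fintype.card K = 2 ^ n) {α β : K} (hαβ : α ≠ 0 ∨ β ≠ 0) (c : K)
    (S : Finset K) (hS : S.card ≤ 3) (h0 : 0 ∈ S) :
    ∃ v, v ∉ S ∧ ∃ x : K, x ^ 2 + x = α * v + β / v + c := by
  classical
  obtain ⟨k, rfl⟩ : ∃ k, n = k + 2 := ⟨n - 2, by omega⟩
  have hk : 4 ≤ 2 ^ k := by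
    calc 4 = 2 ^ 2 := rfl
      _ ≤ 2 ^ k := Nat.pow_le_pow_right two_pos (by omega)
  by_contra! hno
  have hone : ∀ v ∉ S, sumConj (k + 2) (α * v + β / v + c) = 1 := by
    intro v hv
    set y := α * v + β / v + c
    have h1 : sumConj (k + 2) y ≠ 0 := fun h => by
      obtain ⟨x, hx⟩ := exists_sq_add_self_eq hK h
      exact hno v hv x hx
    have h2 : sumConj (k + 2) y ^ 2 + sumConj (k + 2) y = 0 := by
      rw [sumConj_sq, ← sumConj_add, sumConj_sq_add_self, ← hK, FiniteField.pow_card,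
        CharTwo.add_self_eq_zero]
    have h3 : sumConj (k + 2) y * (sumConj (k + 2) y + 1) = 0 := by linear_combination h2
    exact CharTwo.add_eq_zero.1 ((mul_eq_zero.1 h3).resolve_left h1)
  open Polynomial in
  let P : K[X] := ∑ i ∈ Finset.range (k + 1), C (α ^ 2 ^ i) * X ^ (2 ^ (k + 1) + 2 ^ i)
    + C (α ^ 2 ^ (k + 1)) * X ^ 1
    + ∑ i ∈ Finset.range (k + 2), C (β ^ 2 ^ i) * X ^ (2 ^ (k + 1) - 2 ^ i)
    + C (sumConj (k + 2) c + 1) * X ^ 2 ^ (k + 1)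
  have hdeg : P.natDegree ≤ 3 * 2 ^ k := by
    have e : 2 ^ (k + 1) = 2 * 2 ^ k := pow_succ' 2 k
    refine Polynomial.natDegree_add_le_of_degree_le (Polynomial.natDegree_add_le_of_degree_le
      (Polynomial.natDegree_add_le_of_degree_le
        (Polynomial.natDegree_sum_le_of_forall_le _ _ fun i hi => ?_) ?_)
      (Polynomial.natDegree_sum_le_of_forall_le _ _ fun i hi => ?_)) ?_
    all_goals refine (Polynomial.natDegree_C_mul_X_pow_le _ _).trans ?_
    · have : 2 ^ i ≤ 2 ^ k :=
        Nat.pow_le_pow_right two_pos (by have := Finset.mem_range.1 hi; omega)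
      omega
    · omega
    · exact (Nat.sub_le _ _).trans (by omega)
    · omega
  have heval : ∀ v ∈ Sᶜ, P.eval v = 0 := by
    intro v hv
    rw [Finset.mem_compl] at hv
    have hv0 : v ≠ 0 := fun h => hv (h ▸ h0)
    have key : P.eval v = v ^ 2 ^ (k + 1) * (sumConj (k + 2) (α * v + β / v + c) + 1) := by
      have hα : v ^ 2 ^ (k + 1) * sumConj (k + 2) (α * v) =
          ∑ i ∈ Finset.range (k + 1), α ^ 2 ^ i * v ^ (2 ^ (k + 1) + 2 ^ i) +
            α ^ 2 ^ (k + 1) * v ^ 1 := by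
        rw [sumConj, Finset.sum_range_succ, mul_add, Finset.mul_sum]
        congr 1
        · exact Finset.sum_congr rfl fun i _ => by ring
        · have := FiniteField.pow_card v
          rw [hK, show 2 ^ (k + 2) = 2 ^ (k + 1) + 2 ^ (k + 1) by ring, pow_add] at this
          rw [mul_pow]
          linear_combination α ^ 2 ^ (k + 1) * this
      have hβ : v ^ 2 ^ (k + 1) * sumConj (k + 2) (β / v) =
          ∑ i ∈ Finset.range (k + 2), β ^ 2 ^ i * v ^ (2 ^ (k + 1) - 2 ^ i) := by
        rw [sumConj, Finset.mul_sum]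
        refine Finset.sum_congr rfl fun i hi => ?_
        have : 2 ^ i ≤ 2 ^ (k + 1) :=
          Nat.pow_le_pow_right two_pos (by have := Finset.mem_range.1 hi; omega)
        rw [pow_sub₀ _ hv0 this, div_pow]
        ring
      rw [sumConj_add, sumConj_add, mul_add, mul_add, mul_add, hα, hβ]
      simp only [P, Polynomial.eval_add, Polynomial.eval_finsetSum, Polynomial.eval_mul,
        Polynomial.eval_C, Polynomial.eval_pow, Polynomial.eval_X]
      ring
    rw [key, hone v hv, CharTwo.add_self_eq_zero, mul_zero]
  have hP : P = 0 := by
    refine Polynomial.eq_zero_of_natDegree_lt_card_of_eval_eq_zero' P Sᶜ heval ?_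
    rw [Finset.card_compl, hK]
    have e : 2 ^ (k + 2) = 4 * 2 ^ k := by ring
    omega
  have e : 2 ^ (k + 1) = 2 * 2 ^ k := pow_succ' 2 k
  have inj : ∀ i : ℕ, 2 ^ i = 1 → i = 0 := fun i h => by simpa using h
  rcases hαβ with h | h
  · apply h
    have h1 : P.coeff (2 ^ (k + 1) + 1) = α := by
      simp only [P, Polynomial.coeff_add, Polynomial.finsetSum_coeff,
        Polynomial.coeff_C_mul_X_pow]
      rw [Finset.sum_eq_single_of_mem 0 (by simp), Finset.sum_eq_zero, if_neg (show ¬ 2 ^ (k + 1) + 1 = 1 by omega),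
        if_neg (show ¬ 2 ^ (k + 1) + 1 = 2 ^ (k + 1) by omega)]
      · simp
      · intro i _
        have : 0 < 2 ^ i := Nat.two_pow_pos i
        exact if_neg (by omega)
      · intro i _ hi
        exact if_neg fun h => hi (inj i (by omega))
    rw [← h1, hP, Polynomial.coeff_zero]
  · apply h
    have h1 : P.coeff (2 ^ (k + 1) - 1) = β := by
      simp only [P, Polynomial.coeff_add, Polynomial.finsetSum_coeff,
        Polynomial.coeff_C_mul_X_pow]
      rw [Finset.sum_eq_zero, Finset.sum_eq_single_of_mem 0 (by simp), if_neg (show ¬ 2 ^ (k + 1) - 1 = 1 by omega),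
        if_neg (show ¬ 2 ^ (k + 1) - 1 = 2 ^ (k + 1) by omega)]
      · simp
      · intro i hi h0
        have : 2 ^ i ≤ 2 ^ (k + 1) :=
          Nat.pow_le_pow_right two_pos (by have := Finset.mem_range.1 hi; omega)
        exact if_neg fun h => h0 (inj i (by omega))
      · intro i _
        have : 0 < 2 ^ i := Nat.two_pow_pos i
        exact if_neg (by omega)
    rw [← h1, hP, Polynomial.coeff_zero]

lemma exists_isSquare_charTwo {K : Type*} [Field K] [Finite K] [CharP K 2] (a : K) :
    ∃ b, b ^ 2 = a := by
  obtain ⟨b, hb⟩ := FiniteField.isSquare_of_char_two (ringChar.eq K 2 ▸ rfl) a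
  exact ⟨b, by rw [hb, sq]⟩

lemma exists_sq_add_self_eq_twisted {K : Type*} [Field K] [Fintype K] [CharP K 2] {n : ℕ}
    (hn : 4 ≤ n) (hK : Fintype.card K = 2 ^ n) (b r g e k : K) :
    ∃ v, v ≠ 0 ∧ v ≠ e ∧ v ≠ k ∧ ∃ x : K, x ^ 2 + x =
      (1 + k / v) * (b * (v + e) ^ 2 + r * (v + e)) + (1 + k / v) ^ 2 * g * (v + e) := by
  classical
  obtain ⟨B, hB⟩ := exists_isSquare_charTwo b
  obtain ⟨h, hh⟩ := exists_isSquare_charTwo (g * e)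
  have split : ∀ v : K, v ≠ 0 →
      (1 + k / v) * (b * (v + e) ^ 2 + r * (v + e)) + (1 + k / v) ^ 2 * g * (v + e) =
        ((B * v) ^ 2 + B * v) + ((k * h / v) ^ 2 + k * h / v) + ((B + b * k + r + g) * v +
          (b * k * e ^ 2 + r * k * e + g * k ^ 2 + k * h) / v +
            (b * e ^ 2 + r * e + r * k + g * e)) := by
    intro v hv
    field_simp
    subst hB
    grind
  have hS : ({0, e, k} : Finset K).card ≤ 3 := Finset.card_le_three
  obtain ⟨v, hv, x, hx⟩ : ∃ v, v ∉ ({0, e, k} : Finset K) ∧ ∃ x : K, x ^ 2 + x =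
      (B + b * k + r + g) * v +
        (b * k * e ^ 2 + r * k * e + g * k ^ 2 + k * h) / v +
          (b * e ^ 2 + r * e + r * k + g * e) := by
    by_cases hne : B + b * k + r + g ≠ 0 ∨ b * k * e ^ 2 + r * k * e + g * k ^ 2 + k * h ≠ 0
    · exact exists_sq_add_self_eq_linear_add_inv hn hK hne _ _ hS (by simp)
    · push Not at hne
      obtain ⟨h1, h2⟩ := hne
      obtain ⟨v, hv⟩ : ∃ v, v ∉ ({0, e, k} : Finset K) := by
        by_contra! hall
        have h3 := Finset.card_le_card (fun x _ => hall x : Finset.univ ⊆ _)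
        rw [Finset.card_univ, hK] at h3
        have : 2 ^ 4 ≤ 2 ^ n := Nat.pow_le_pow_right two_pos hn
        omega
      refine ⟨v, hv, ?_⟩
      rw [h1, h2, zero_mul, zero_div]
      by_cases hk : k = 0
      · refine ⟨B * e, ?_⟩
        subst hB hk
        grind
      · have h4 : b * e ^ 2 + r * e + g * k + h = 0 := by
          apply mul_left_cancel₀ hk
          linear_combination h2
        refine ⟨B * k + h, ?_⟩
        subst hB
        grind
  simp only [Finset.mem_insert, Finset.mem_singleton, not_or] at hv
  refine ⟨v, hv.1, hv.2.1, hv.2.2, B * v + k * h / v + x, ?_⟩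
  rw [split v hv.1, ← hx]
  grind

lemma exists_solution_normalized {K : Type*} [Field K] [Fintype K] [CharP K 2] {n : ℕ}
    (hn : 4 ≤ n) (hK : Fintype.card K = 2 ^ n) (l e b r g : K) :
    ∃ x y s : K, x ≠ 0 ∧ y ≠ 0 ∧ 1 + y + x * l + x * y * e = 0 ∧
      b + x * r + x * y * g + y * s ^ 2 + x * s = 0 := by
  obtain ⟨v, hv0, hve, hvk, z, hz⟩ := exists_sq_add_self_eq_twisted hn hK b r g e (e + l)
  have h1 : v + e ≠ 0 := fun h => hve (CharTwo.add_eq_zero.1 h)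
  have h2 : v + e + l ≠ 0 := fun h => hvk (CharTwo.add_eq_zero.1 (by rw [← h]; ring))
  refine ⟨1 / (v + e), (v + e + l) / v, v / ((v + e) * (v + e + l)) * z,
    one_div_ne_zero h1, div_ne_zero h2 hv0, ?_, ?_⟩
  · field_simp
    grind
  · field_simp
    field_simp at hz
    grind

lemma exists_solution {K : Type*} [Field K] [Fintype K] [CharP K 2] {n : ℕ}
    (hn : 4 ≤ n) (hK : Fintype.card K = 2 ^ n) {b₁ m₁ : K} (hb : b₁ ≠ 0) (hm : m₁ ≠ 0)
    (b₀ m₀ l₀ l₁ e₀ e₁ : K) :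
    ∃ x y s : K, x ≠ 0 ∧ y ≠ 0 ∧ b₁ + y * m₁ + x * l₁ + x * y * e₁ = 0 ∧
      b₀ + y * m₀ + x * l₀ + x * y * e₀ + y * s ^ 2 + x * s = 0 := by
  obtain ⟨σ, hσ⟩ := exists_isSquare_charTwo m₀
  obtain ⟨x, y, s, hx, hy, h1, h2⟩ := exists_solution_normalized hn hK (l₁ / m₁)
    (e₁ * b₁ / m₁ ^ 2) (b₀ * m₁ / b₁) (l₀ + σ) (e₀ * b₁ / m₁)
  refine ⟨b₁ / m₁ * x, b₁ / m₁ * y, s + σ, by positivity, by positivity, ?_, ?_⟩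
  · field_simp at h1 ⊢
    linear_combination b₁ * h1
  · subst hσ
    field_simp at h2 ⊢
    grind

lemma exists_map_eq_of_pow_card_eq {K F : Type*} [Field K] [Fintype K] [Field F] (φ : K →+* F)
    {z : F} (hz : z ^ Fintype.card K = z) : ∃ k, φ k = z := by
  classical
  by_contra hne
  let S : Finset F := insert z (Finset.univ.image φ)
  have hS : S.card = Fintype.card K + 1 := by
    rw [Finset.card_insert_of_notMem, Finset.card_image_of_injective _ φ.injective,
      Finset.card_univ]
    intro h
    obtain ⟨x, -, hx⟩ := Finset.mem_image.1 h
    exact hne ⟨x, hx⟩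
  have hdeg := FiniteField.X_pow_card_sub_X_natDegree_eq F (Fintype.one_lt_card (α := K))
  refine FiniteField.X_pow_card_sub_X_ne_zero F (Fintype.one_lt_card (α := K))
    (Polynomial.eq_zero_of_natDegree_lt_card_of_eval_eq_zero' _ S (fun x hx => ?_) (by omega))
  simp only [Polynomial.eval_sub, Polynomial.eval_pow, Polynomial.eval_X]
  rcases Finset.mem_insert.1 hx with rfl | hx
  · rw [hz, sub_self]
  · obtain ⟨y, -, rfl⟩ := Finset.mem_image.1 hx
    rw [← map_pow, FiniteField.pow_card, sub_self]

lemma exists_fixed_solution {F : Type*} [Field F] [Fintype F] [CharP F 2] {n : ℕ} (hn : 4 ≤ n)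
    (hF : Fintype.card F = (2 ^ n) ^ 2) {b m ω : F} (hb : b ^ 2 ^ n ≠ b) (hm : m ^ 2 ^ n ≠ m)
    (hω : ω ^ 2 ^ n = ω + 1) (l e : F) :
    ∃ x y s : F, x ^ 2 ^ n = x ∧ y ^ 2 ^ n = y ∧ s ^ 2 ^ n = s ∧ x ≠ 0 ∧ y ≠ 0 ∧
      b + y * m + x * l + x * y * e + y * s ^ 2 + x * s = 0 := by
  have hn0 : n ≠ 0 := by omega
  let K := GaloisField 2 n
  let _ : Fintype K := Fintype.ofFinite K
  have hK : Fintype.card K = 2 ^ n := by rw [← Nat.card_eq_fintype_card, GaloisField.card 2 n hn0]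
  let _ : Algebra (ZMod 2) F := ZMod.algebra F 2
  have hfr : Module.finrank (ZMod 2) F = n * 2 := by
    have h := Module.card_eq_pow_finrank (K := ZMod 2) (V := F)
    rw [hF, ZMod.card, ← pow_mul] at h
    exact (Nat.pow_right_injective le_rfl h).symm
  obtain ⟨ψ⟩ : Nonempty (K →ₐ[ZMod 2] F) :=
    FiniteField.nonempty_algHom_of_finrank_dvd (by
      rw [hfr, GaloisField.finrank 2 hn0]; exact dvd_mul_right n 2)
  let φ : K →+* F := ψ
  have hφ : ∀ k, φ k ^ 2 ^ n = φ k := fun k => by rw [← map_pow, ← hK, FiniteField.pow_card]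
  have hconj : ∀ z : F, (z ^ 2 ^ n) ^ 2 ^ n = z := fun z => by
    rw [← pow_mul, ← sq, ← hF, FiniteField.pow_card]
  have hdec : ∀ z : F, ∃ r i : K, z = φ r + φ i * ω ∧ (z ^ 2 ^ n ≠ z → i ≠ 0) := by
    intro z
    obtain ⟨i, hi⟩ := exists_map_eq_of_pow_card_eq φ (z := z + z ^ 2 ^ n) (by
      rw [hK, add_pow_char_pow, hconj, add_comm])
    obtain ⟨r, hr⟩ := exists_map_eq_of_pow_card_eq φ (z := z + φ i * ω) (by
      rw [hK, add_pow_char_pow, mul_pow, hφ, hω, hi]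
      grind)
    refine ⟨r, i, by grind, ?_⟩
    rintro h rfl
    rw [map_zero] at hi
    exact h (CharTwo.add_eq_zero.1 hi.symm).symm
  obtain ⟨b₀, b₁, rfl, hb₁⟩ := hdec b
  obtain ⟨m₀, m₁, rfl, hm₁⟩ := hdec m
  obtain ⟨l₀, l₁, rfl, -⟩ := hdec l
  obtain ⟨e₀, e₁, rfl, -⟩ := hdec e
  obtain ⟨x, y, s, hx, hy, h1, h0⟩ :=
    exists_solution hn hK (hb₁ hb) (hm₁ hm) b₀ m₀ l₀ l₁ e₀ e₁
  refine ⟨φ x, φ y, φ s, hφ x, hφ y, hφ s, (map_ne_zero φ).2 hx, (map_ne_zero φ).2 hy, ?_⟩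
  have h1' := congrArg φ h1
  have h0' := congrArg φ h0
  simp only [map_add, map_mul, map_pow, map_zero] at h1' h0'
  linear_combination h0' + ω * h1'

lemma exists_pow_eq_add_one {F : Type*} [Field F] [CharP F 2] {n : ℕ} {z : F}
    (hz : z ^ 2 ^ n ≠ z) (hzz : (z ^ 2 ^ n) ^ 2 ^ n = z) : ∃ ω : F, ω ^ 2 ^ n = ω + 1 := by
  have h : z + z ^ 2 ^ n ≠ 0 := fun h => hz (CharTwo.add_eq_zero.1 h).symm
  refine ⟨z / (z + z ^ 2 ^ n), ?_⟩
  rw [div_pow, add_pow_char_pow, hzz, add_comm (z ^ 2 ^ n) z]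
  field_simp
  grind

lemma exists_nondegenerate_direction {F : Type*} [Field F] [Fintype F] [CharP F 2] {n : ℕ}
    (hn : 4 ≤ n) (hF : Fintype.card F = (2 ^ n) ^ 2) (A B C D : F)
    (hB : B * C ^ 2 ^ n + B ^ 2 ^ n * D ≠ 0 ∨ B + B ^ 2 ^ n * A ≠ 0)
    (hA : A ^ (2 ^ n + 1) + C ^ (2 ^ n + 1) + D ^ (2 ^ n + 1) + 1 ≠ 0 ∨
      A * D ^ 2 ^ n + C ≠ 0) :
    ∃ a : F, a ≠ 0 ∧
      (B * A ^ 2 ^ n + B ^ 2 ^ n) * a ^ (3 * 2 ^ n) +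
        (B * D ^ 2 ^ n + B ^ 2 ^ n * C) * a ^ (2 * 2 ^ n + 1) +
        (B * C ^ 2 ^ n + B ^ 2 ^ n * D) * a ^ (2 ^ n + 2) + (B + B ^ 2 ^ n * A) * a ^ 3 ≠ 0 ∧
      (A ^ (2 ^ n + 1) + C ^ (2 ^ n + 1) + D ^ (2 ^ n + 1) + 1) * a ^ (3 * 2 ^ n + 3) +
        (A * D ^ 2 ^ n + C) * a ^ (2 * 2 ^ n + 4) +
        (A ^ 2 ^ n * D + C ^ 2 ^ n) * a ^ (4 * 2 ^ n + 2) ≠ 0 := by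
  have hq : 2 ^ 4 ≤ 2 ^ n := Nat.pow_le_pow_right two_pos hn
  generalize 2 ^ n = q at *
  open Polynomial in
  let P : F[X] := Polynomial.C (B * A ^ q + B ^ q) * X ^ (3 * q) +
    Polynomial.C (B * D ^ q + B ^ q * C) * X ^ (2 * q + 1) +
    Polynomial.C (B * C ^ q + B ^ q * D) * X ^ (q + 2) + Polynomial.C (B + B ^ q * A) * X ^ 3
  open Polynomial in
  let Q : F[X] :=
    Polynomial.C (A ^ (q + 1) + C ^ (q + 1) + D ^ (q + 1) + 1) * X ^ (3 * q + 3) +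
    Polynomial.C (A * D ^ q + C) * X ^ (2 * q + 4) +
    Polynomial.C (A ^ q * D + C ^ q) * X ^ (4 * q + 2)
  have hP : P ≠ 0 := by
    intro h
    have h1 : P.coeff (q + 2) = B * C ^ q + B ^ q * D := by
      simp only [P, Polynomial.coeff_add, Polynomial.coeff_C_mul_X_pow]
      rw [if_neg (by omega), if_neg (by omega), if_pos trivial, if_neg (by omega)]
      ring
    have h2 : P.coeff 3 = B + B ^ q * A := by
      simp only [P, Polynomial.coeff_add, Polynomial.coeff_C_mul_X_pow]
      rw [if_neg (by omega), if_neg (by omega), if_neg (by omega), if_pos trivial]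
      ring
    rw [h, Polynomial.coeff_zero] at h1 h2
    exact hB.elim (· h1.symm) (· h2.symm)
  have hQ : Q ≠ 0 := by
    intro h
    have h1 : Q.coeff (3 * q + 3) = A ^ (q + 1) + C ^ (q + 1) + D ^ (q + 1) + 1 := by
      simp only [Q, Polynomial.coeff_add, Polynomial.coeff_C_mul_X_pow]
      rw [if_pos trivial, if_neg (by omega), if_neg (by omega)]
      ring
    have h2 : Q.coeff (2 * q + 4) = A * D ^ q + C := by
      simp only [Q, Polynomial.coeff_add, Polynomial.coeff_C_mul_X_pow]
      rw [if_neg (by omega), if_pos trivial, if_neg (by omega)]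
      ring
    rw [h, Polynomial.coeff_zero] at h1 h2
    exact hA.elim (· h1.symm) (· h2.symm)
  have hPdeg : P.natDegree ≤ 3 * q := by
    refine Polynomial.natDegree_add_le_of_degree_le (Polynomial.natDegree_add_le_of_degree_le
      (Polynomial.natDegree_add_le_of_degree_le ?_ ?_) ?_) ?_
    all_goals exact (Polynomial.natDegree_C_mul_X_pow_le _ _).trans (by omega)
  have hQdeg : Q.natDegree ≤ 4 * q + 2 := by
    refine Polynomial.natDegree_add_le_of_degree_le
      (Polynomial.natDegree_add_le_of_degree_le ?_ ?_) ?_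
    all_goals exact (Polynomial.natDegree_C_mul_X_pow_le _ _).trans (by omega)
  by_contra! hall
  refine mul_ne_zero (mul_ne_zero Polynomial.X_ne_zero hP) hQ
    (Polynomial.eq_zero_of_natDegree_lt_card_of_eval_eq_zero' _ Finset.univ (fun a _ => ?_) ?_)
  · have hPa : P.eval a = (B * A ^ q + B ^ q) * a ^ (3 * q) +
        (B * D ^ q + B ^ q * C) * a ^ (2 * q + 1) +
        (B * C ^ q + B ^ q * D) * a ^ (q + 2) + (B + B ^ q * A) * a ^ 3 := by simp [P]
    have hQa : Q.eval a = (A ^ (q + 1) + C ^ (q + 1) + D ^ (q + 1) + 1) * a ^ (3 * q + 3) +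
        (A * D ^ q + C) * a ^ (2 * q + 4) + (A ^ q * D + C ^ q) * a ^ (4 * q + 2) := by simp [Q]
    rw [Polynomial.eval_mul, Polynomial.eval_mul, Polynomial.eval_X]
    by_cases ha : a = 0
    · simp [ha]
    by_cases hPa0 : P.eval a = 0
    · simp [hPa0]
    · rw [hQa, hall a ha (hPa ▸ hPa0), mul_zero]
  · rw [Finset.card_univ, hF]
    have h1 := Polynomial.natDegree_mul_le (p := Polynomial.X * P) (q := Q)
    have h2 := Polynomial.natDegree_mul_le (p := (Polynomial.X : Polynomial F)) (q := P)
    rw [Polynomial.natDegree_X] at h2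
    nlinarith

lemma collision_identity {R : Type*} [CommRing R] [CharP R 2] {A B C D E a c x y w : R}
    (h : B * (a * c) + y * (w ^ 2 * (A * a ^ 3 + D * (c * a ^ 2) + (C * (c ^ 2 * a) + c ^ 3)) +
        (C * (c ^ 2 * a) + c ^ 3)) +
      x * (w * (A * a ^ 3 + D * (c * a ^ 2) + (C * (c ^ 2 * a) + c ^ 3)) +
        (D * (c * a ^ 2) + c ^ 3)) + x * y * (E * (a * c) ^ 2) = 0) {f : R → R → R}
    (hf : ∀ u v, f u v = A * u ^ 3 + B * (v * u) + C * (v ^ 2 * u) + D * (v * u ^ 2) +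
      E * (v ^ 2 * u ^ 2) + v ^ 3) :
    f (y * (a * w) + x * a) (y * (c * (w + 1)) + x * c) + f (y * (a * w)) (y * (c * (w + 1))) =
      f (x * a) (x * c) := by
  simp only [hf]
  have h2 : (2 : R) = 0 := CharTwo.two_eq_zero
  have h4 : (4 : R) = 0 := by linear_combination 2 * h2
  have h6 : (6 : R) = 0 := by linear_combination 3 * h2
  linear_combination (norm := (ring_nf; simp only [h2, h4, h6, mul_zero, add_zero])) x * y * h

lemma norm_identity {K : Type*} [Field K] [CharP K 2] {P P' Q Q' : K}
    (hG : P + Q ≠ 0) (hG' : P' + Q' ≠ 0)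
    (h : 1 + Q' / (P' + Q') = Q / (P + Q)) : P * P' + Q * Q' = 0 := by
  field_simp at h
  grind

lemma dillon_eq {F : Type*} [Field F] (q : ℕ) (A B C D E x : F) :
    dillon q A B C D E x = A * x ^ 3 + B * (x ^ q * x) + C * ((x ^ q) ^ 2 * x) +
      D * (x ^ q * x ^ 2) + E * ((x ^ q) ^ 2 * x ^ 2) + (x ^ q) ^ 3 := by
  unfold dillon
  ring

lemma not_isAPN_of_collision {F : Type*} [Field F] [Finite F] {f : F → F} (h0 : f 0 = 0)
    {a x : F} (ha : a ≠ 0) (hx0 : x ≠ 0) (hxa : x ≠ a) (h : f (x + a) + f x = f a)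
    (haa : f (a + a) = 0) : ¬ IsAPN f := by
  intro hf
  have h2 : 2 < {z : F | f (z + a) + f z = f a}.ncard := by
    rw [Set.two_lt_ncard_iff (Set.toFinite _)]
    exact ⟨0, a, x, by simp [h0], by simp [haa], h, ha.symm, hx0.symm, hxa.symm⟩
  exact absurd (hf a (f a) ha) (by omega)

lemma not_isAPN_dillon {F : Type*} [Field F] [Fintype F] {n : ℕ} (hn : 4 ≤ n)
    (hF : Fintype.card F = (2 ^ n) ^ 2) (A B C D E : F)
    (hA : ¬ (A * D ^ 2 ^ n + C = 0 ∧
      A ^ (2 ^ n + 1) + C ^ (2 ^ n + 1) + D ^ (2 ^ n + 1) + 1 = 0))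
    (hh : h1Poly (2 ^ n) A B C D ≠ 0) : ¬ IsAPN (dillon (2 ^ n) A B C D E) := by
  have : CharP F 2 := charP_of_card_eq_prime_pow (by rw [hF, ← pow_mul])
  have hq : 2 ^ n ≠ 0 := by positivity
  have hconj : ∀ z : F, (z ^ 2 ^ n) ^ 2 ^ n = z := fun z => by
    rw [← pow_mul, ← sq, ← hF, FiniteField.pow_card]
  have hadd : ∀ z w : F, (z + w) ^ 2 ^ n = z ^ 2 ^ n + w ^ 2 ^ n := fun z w =>
    add_pow_char_pow z w 2 n
  obtain ⟨a, ha, hBa, hAa⟩ := exists_nondegenerate_direction hn hF A B C D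
    (by
      by_contra! h
      apply hh
      have e : h1Poly (2 ^ n) A B C D = (B + B ^ 2 ^ n * A) * (B ^ 2 ^ n + A ^ 2 ^ n * B) +
          (B * C ^ 2 ^ n + B ^ 2 ^ n * D) * (B * D ^ 2 ^ n + B ^ 2 ^ n * C) := by
        unfold h1Poly
        ring
      rw [e, h.1, h.2, zero_mul, zero_mul, add_zero])
    (by
      by_contra! h
      exact hA ⟨h.2, h.1⟩)
  obtain ⟨c, hc⟩ : ∃ c, a ^ 2 ^ n = c := ⟨_, rfl⟩
  have hc' : c ^ 2 ^ n = a := by rw [← hc, hconj]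
  set P := A * a ^ 3 + D * (c * a ^ 2) with hP
  set Q := C * (c ^ 2 * a) + c ^ 3 with hQ
  have hPc : P ^ 2 ^ n = A ^ 2 ^ n * c ^ 3 + D ^ 2 ^ n * (a * c ^ 2) := by
    simp only [hP, hadd, mul_pow, ← hc, pow_right_comm _ _ (2 ^ n), hconj]
  have hQc : Q ^ 2 ^ n = C ^ 2 ^ n * (a ^ 2 * c) + a ^ 3 := by
    simp only [hQ, hadd, mul_pow, ← hc, pow_right_comm _ _ (2 ^ n), hconj]
  have hpow : ∀ i j : ℕ, a ^ (i * 2 ^ n + j) = c ^ i * a ^ j := fun i j => by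
    rw [pow_add, mul_comm i, pow_mul, hc]
  have hBG : B * (P + Q) ^ 2 ^ n + B ^ 2 ^ n * (P + Q) ≠ 0 := by
    have h1 := hpow 3 0
    have h2 := hpow 1 2
    rw [add_zero] at h1
    rw [one_mul] at h2
    rw [h1, hpow, h2] at hBa
    convert hBa using 1
    rw [hadd, hPc, hQc, hP, hQ]
    ring
  have hPQ : P * P ^ 2 ^ n + Q * Q ^ 2 ^ n ≠ 0 := by
    rw [hpow, hpow, hpow] at hAa
    convert hAa using 1
    rw [hPc, hQc, hP, hQ]
    ring
  have hG : P + Q ≠ 0 := fun h => hBG (by rw [h, zero_pow hq, mul_zero, mul_zero, add_zero])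
  have hGc : (P + Q) ^ 2 ^ n ≠ 0 := pow_ne_zero _ hG
  have hac : a * c ≠ 0 := mul_ne_zero ha (hc ▸ pow_ne_zero _ ha)
  have hacc : (a * c) ^ 2 ^ n = a * c := by rw [mul_pow, hc, hc', mul_comm]
  have hb : (B * (a * c) / (P + Q)) ^ 2 ^ n ≠ B * (a * c) / (P + Q) := by
    rw [div_pow, mul_pow, hacc]
    intro h
    rw [div_eq_div_iff hGc hG] at h
    apply hBG
    apply mul_left_cancel₀ hac
    linear_combination h + CharTwo.add_self_eq_zero (B * (a * c) * (P + Q) ^ 2 ^ n)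
  obtain ⟨ω, hω⟩ := exists_pow_eq_add_one hb (hconj _)
  have hm : (ω ^ 2 + Q / (P + Q)) ^ 2 ^ n ≠ ω ^ 2 + Q / (P + Q) := by
    rw [hadd (ω ^ 2), div_pow, pow_right_comm, hω, CharTwo.add_sq, hadd P Q]
    intro h
    rw [hadd P Q] at hGc
    exact hPQ (norm_identity hG hGc (by linear_combination h))
  obtain ⟨x, y, s, hx, hy, hs, hx0, hy0, hxy⟩ := exists_fixed_solution hn hF hb hm hω
    (ω + (D * (c * a ^ 2) + c ^ 3) / (P + Q)) (E * (a * c) ^ 2 / (P + Q))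
  have hw : (ω + s) ^ 2 ^ n = ω + s + 1 := by rw [hadd, hω, hs]; ring
  have hxyG : B * (a * c) + y * ((ω + s) ^ 2 * (P + Q) + Q) +
      x * ((ω + s) * (P + Q) + (D * (c * a ^ 2) + c ^ 3)) + x * y * (E * (a * c) ^ 2) = 0 := by
    rw [CharTwo.add_sq]
    field_simp at hxy
    linear_combination hxy
  have hzero : dillon (2 ^ n) A B C D E 0 = 0 := by simp [dillon]
  refine not_isAPN_of_collision hzero (a := x * a) (x := y * (a * (ω + s)))
    (mul_ne_zero hx0 ha) ?_ ?_ ?_ (by rw [CharTwo.add_self_eq_zero, hzero])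
  · refine mul_ne_zero hy0 (mul_ne_zero ha fun h => ?_)
    rw [h, zero_pow hq, zero_add] at hw
    exact zero_ne_one hw
  · intro h
    have h1 : y * (ω + s) = x := by
      apply mul_left_cancel₀ ha
      linear_combination h
    have h2 := congrArg (· ^ 2 ^ n) h1
    simp only [mul_pow, hy, hx, hw] at h2
    exact hy0 (by linear_combination h2 - h1)
  · simp only [dillon_eq, hadd, mul_pow, hx, hy, hs, hω, hc]
    have key := collision_identity hxyG (fun u v => rfl)
    simp only [add_right_comm _ _ s]
    simpa only [mul_pow] using key

theorem statement10 :
    ∃ n₀ : ℕ, 0 < n₀ ∧ ∀ n : ℕ, n₀ ≤ n → ∀ q : ℕ, q = 2 ^ n →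
      ∀ (F : Type) [Field F] [Fintype F], Fintype.card F = q ^ 2 →
        ∀ A B C D E : F,
          ¬ CondC1 q A B C D E → ¬ CondC2 q A B C D E →
          ¬ (A * D ^ q + C = 0 ∧
              A ^ (q + 1) + C ^ (q + 1) + D ^ (q + 1) + 1 = 0) →
          h1Poly q A B C D ≠ 0 →
          ¬ IsAPN (dillon q A B C D E) := by
  refine ⟨4, by norm_num, ?_⟩
  rintro n hn q rfl F _ _ hF A B C D E - - hA hh
  exact not_isAPN_dillon hn hF A B C D E hA hh
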